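/- arXiv:1604.03155 — 3 statements merged into one kernel-verified Lean document; each statement's English description precedes it below -/
import Mathlib

section
/- Let σ > 0 and let ρ : ℝ³ → ℝ be the Gaussian ρ(y) = (1/(σ³(2π)^{3/2})) e^{−|y|²/(2σ²)}. Then for every x ∈ ℝ³ with x ≠ 0, writing r = |x|, the biharmonic potential of ρ satisfies ∫_{ℝ³} (|x−y|/(8π)) ρ(y) dy = (1/(8π)) [ σ √(2/π) e^{−r²/(2σ²)} + erf(r/(√2 σ)) (σ²/r + r) ]. -/
open MeasureTheory

/-- The error function `erf(t) = (2/√π) ∫₀^t e^{−u²} du`. -/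
noncomputable def erf (t : ℝ) : ℝ :=
  (2 / Real.sqrt Real.pi) * ∫ u in (0 : ℝ)..t, Real.exp (-u ^ 2)

open Real Set Filter Topology

/-- The dilation `s ↦ s / √(1 + c s²)` of the half-line that turns Gaussian averages of Gaussians
into Gaussians. -/
noncomputable def contraction (c s : ℝ) : ℝ := s / √(1 + c * s ^ 2)

/-- The primitive vanishing at `0` of `s ↦ (1 - exp (-k w²) / (1 + c s²) ^ (3/2)) / s²`, where
`w = contraction c s`. -/
noncomputable def gaussianPrimitive (c k s : ℝ) : ℝ :=
  (rexp (-k * contraction c s ^ 2) * √(1 + c * s ^ 2) - 1) / s +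
    (2 * k + c) * ∫ u in (0 : ℝ)..contraction c s, rexp (-k * u ^ 2)

lemma one_add_mul_sq_pos {c : ℝ} (hc : 0 ≤ c) (s : ℝ) : 0 < 1 + c * s ^ 2 := by positivity

lemma hasDerivAt_sqrt_one_add_mul_sq {c : ℝ} (hc : 0 ≤ c) (s : ℝ) :
    HasDerivAt (fun s ↦ √(1 + c * s ^ 2)) (c * s / √(1 + c * s ^ 2)) s := by
  have h : HasDerivAt (fun s : ℝ ↦ 1 + c * s ^ 2) (c * (2 * s)) s := by
    simpa using ((hasDerivAt_pow 2 s).const_mul c).const_add 1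
  convert h.sqrt (one_add_mul_sq_pos hc s).ne' using 1
  field_simp

lemma hasDerivAt_contraction {c : ℝ} (hc : 0 ≤ c) (s : ℝ) :
    HasDerivAt (contraction c) (1 / √(1 + c * s ^ 2) ^ 3) s := by
  have hq : 0 < √(1 + c * s ^ 2) := sqrt_pos.2 (one_add_mul_sq_pos hc s)
  have hq2 := sq_sqrt (one_add_mul_sq_pos hc s).le
  refine ((hasDerivAt_id s).div (hasDerivAt_sqrt_one_add_mul_sq hc s) hq.ne').congr_deriv ?_
  simp only [id]
  generalize √(1 + c * s ^ 2) = q at *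
  field_simp
  linear_combination hq2

lemma hasDerivAt_exp_contraction_mul_sqrt {c : ℝ} (hc : 0 ≤ c) (k s : ℝ) :
    HasDerivAt (fun s ↦ rexp (-k * contraction c s ^ 2) * √(1 + c * s ^ 2))
      (rexp (-k * contraction c s ^ 2) * s *
        (c / √(1 + c * s ^ 2) - 2 * k / √(1 + c * s ^ 2) ^ 3)) s := by
  have hq : 0 < √(1 + c * s ^ 2) := sqrt_pos.2 (one_add_mul_sq_pos hc s)
  refine (((((hasDerivAt_contraction hc s).pow 2).const_mul (-k)).exp).mul
    (hasDerivAt_sqrt_one_add_mul_sq hc s)).congr_deriv ?_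
  simp only [Pi.pow_apply]
  have hw : contraction c s = s / √(1 + c * s ^ 2) := rfl
  generalize rexp (-k * contraction c s ^ 2) = E
  rw [hw]
  generalize √(1 + c * s ^ 2) = q at *
  norm_num
  field_simp
  ring

lemma hasDerivAt_integral_gaussian (k w : ℝ) :
    HasDerivAt (fun w ↦ ∫ u in (0 : ℝ)..w, rexp (-k * u ^ 2)) (rexp (-k * w ^ 2)) w :=
  (Continuous.integral_hasStrictDerivAt (by fun_prop) 0 w).hasDerivAt

lemma hasDerivAt_gaussianPrimitive {c : ℝ} (hc : 0 ≤ c) (k : ℝ) {s : ℝ} (hs : 0 < s) :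
    HasDerivAt (gaussianPrimitive c k)
      ((1 - rexp (-k * contraction c s ^ 2) / √(1 + c * s ^ 2) ^ 3) / s ^ 2) s := by
  have hq : 0 < √(1 + c * s ^ 2) := sqrt_pos.2 (one_add_mul_sq_pos hc s)
  have hq2 := sq_sqrt (one_add_mul_sq_pos hc s).le
  refine ((((hasDerivAt_exp_contraction_mul_sqrt hc k s).sub_const 1).div (hasDerivAt_id s)
    hs.ne').add (((hasDerivAt_integral_gaussian k (contraction c s)).comp s
      (hasDerivAt_contraction hc s)).const_mul (2 * k + c))).congr_deriv ?_
  simp only [id]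
  generalize rexp (-k * contraction c s ^ 2) = E
  generalize √(1 + c * s ^ 2) = q at *
  field_simp
  linear_combination -E * (1 + q ^ 2) * hq2

lemma gaussianPrimitive_zero (c k : ℝ) : gaussianPrimitive c k 0 = 0 := by
  simp [gaussianPrimitive, contraction]

lemma continuousAt_gaussianPrimitive_zero {c : ℝ} (hc : 0 ≤ c) (k : ℝ) :
    ContinuousAt (gaussianPrimitive c k) 0 := by
  refine ContinuousAt.add ?_ (ContinuousAt.const_mul ?_ _)
  · have h := hasDerivAt_iff_tendsto_slope.1 (hasDerivAt_exp_contraction_mul_sqrt hc k 0)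
    rw [← continuousWithinAt_compl_self]
    simpa [ContinuousWithinAt, slope_fun_def_field, contraction] using h
  · exact ((hasDerivAt_integral_gaussian k (contraction c 0)).comp 0
      (hasDerivAt_contraction hc 0)).continuousAt

lemma exp_contraction_div_le_one {c k : ℝ} (hc : 0 ≤ c) (hk : 0 ≤ k) (s : ℝ) :
    rexp (-k * contraction c s ^ 2) / √(1 + c * s ^ 2) ^ 3 ≤ 1 := by
  have h1 : 1 ≤ √(1 + c * s ^ 2) := one_le_sqrt.2 (by nlinarith [mul_nonneg hc (sq_nonneg s)])
  rw [div_le_one (by positivity)]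
  refine (exp_le_one_iff.2 ?_).trans (one_le_pow₀ h1)
  nlinarith [mul_nonneg hk (sq_nonneg (contraction c s))]

lemma integrableOn_and_integral_of_tendsto_gaussianPrimitive {c k l : ℝ} (hc : 0 ≤ c) (hk : 0 ≤ k)
    (hl : Tendsto (gaussianPrimitive c k) atTop (𝓝 l)) :
    IntegrableOn (fun s ↦ (1 - rexp (-k * contraction c s ^ 2) / √(1 + c * s ^ 2) ^ 3) / s ^ 2)
      (Ioi 0) ∧
    ∫ s in Ioi 0, (1 - rexp (-k * contraction c s ^ 2) / √(1 + c * s ^ 2) ^ 3) / s ^ 2 = l := by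
  have hcont := (continuousAt_gaussianPrimitive_zero hc k).continuousWithinAt (s := Ici 0)
  have hderiv : ∀ s ∈ Ioi (0 : ℝ), HasDerivAt (gaussianPrimitive c k)
      ((1 - rexp (-k * contraction c s ^ 2) / √(1 + c * s ^ 2) ^ 3) / s ^ 2) s :=
    fun s hs ↦ hasDerivAt_gaussianPrimitive hc k hs
  have hpos : ∀ s ∈ Ioi (0 : ℝ),
      0 ≤ (1 - rexp (-k * contraction c s ^ 2) / √(1 + c * s ^ 2) ^ 3) / s ^ 2 :=
    fun s _ ↦ div_nonneg (sub_nonneg.2 (exp_contraction_div_le_one hc hk s)) (sq_nonneg s)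
  refine ⟨integrableOn_Ioi_deriv_of_nonneg hcont hderiv hpos hl, ?_⟩
  rw [integral_Ioi_of_hasDerivAt_of_nonneg hcont hderiv hpos hl, gaussianPrimitive_zero, sub_zero]

lemma tendsto_gaussianPrimitive_atTop_of_pos {c : ℝ} (hc : 0 < c) (k : ℝ) :
    Tendsto (gaussianPrimitive c k) atTop
      (𝓝 (√c * rexp (-k / c) + (2 * k + c) * ∫ u in (0 : ℝ)..1 / √c, rexp (-k * u ^ 2))) := by
  have hinv : Tendsto (fun s : ℝ ↦ s⁻¹) atTop (𝓝 0) := tendsto_inv_atTop_zero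
  have hqs : Tendsto (fun s : ℝ ↦ √(1 + c * s ^ 2) / s) atTop (𝓝 (√c)) := by
    have h : Tendsto (fun s : ℝ ↦ √(s⁻¹ ^ 2 + c)) atTop (𝓝 √c) := by
      have := ((hinv.pow 2).add_const c).sqrt
      simpa using this
    refine h.congr' ?_
    filter_upwards [eventually_gt_atTop 0] with s hs
    rw [← sqrt_sq hs.le, ← sqrt_div (by positivity), sqrt_sq hs.le]
    congr 1
    field_simp
  have hw : Tendsto (contraction c) atTop (𝓝 (1 / √c)) := by
    have h := hqs.inv₀ (sqrt_pos.2 hc).ne'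
    simpa [show contraction c = fun s ↦ s / √(1 + c * s ^ 2) from rfl] using h
  have hE : Tendsto (fun s ↦ rexp (-k * contraction c s ^ 2)) atTop (𝓝 (rexp (-k / c))) := by
    have h := ((hw.pow 2).const_mul (-k)).rexp
    rwa [div_pow, sq_sqrt hc.le, one_pow, mul_one_div] at h
  have hΦ := (hasDerivAt_integral_gaussian k (1 / √c)).continuousAt.tendsto.comp hw
  have h := ((hqs.mul hE).sub hinv).add (hΦ.const_mul (2 * k + c))
  rw [sub_zero] at h
  refine h.congr fun s ↦ ?_
  simp only [gaussianPrimitive, Function.comp_apply]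
  ring

lemma tendsto_gaussianPrimitive_zero_atTop {a : ℝ} (ha : 0 < a) :
    Tendsto (gaussianPrimitive 0 (a ^ 2)) atTop (𝓝 (a * √π)) := by
  have ha2 : 0 < a ^ 2 := by positivity
  have hinv : Tendsto (fun s : ℝ ↦ s⁻¹) atTop (𝓝 0) := tendsto_inv_atTop_zero
  have hΦ := intervalIntegral_tendsto_integral_Ioi (μ := volume) 0
    (integrable_exp_neg_mul_sq ha2).integrableOn tendsto_id
  rw [integral_gaussian_Ioi, sqrt_div pi_pos.le, sqrt_sq ha.le] at hΦ
  have hE : Tendsto (fun s : ℝ ↦ rexp (-a ^ 2 * s ^ 2)) atTop (𝓝 0) := by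
    refine tendsto_exp_atBot.comp ?_
    exact (tendsto_pow_atTop two_ne_zero).const_mul_atTop_of_neg (neg_lt_zero.2 ha2)
  have h := ((hE.mul hinv).sub hinv).add (hΦ.const_mul (2 * a ^ 2))
  convert h.congr fun s ↦ ?_ using 2
  · field_simp
    ring
  · simp only [gaussianPrimitive, contraction, id]
    simp
    ring

lemma integral_one_sub_exp_div_sq {a : ℝ} (ha : 0 ≤ a) :
    ∫ s in Ioi 0, (1 - rexp (-s ^ 2 * a ^ 2)) / s ^ 2 = a * √π := by
  rcases ha.eq_or_lt with rfl | ha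
  · simp
  · have h := (integrableOn_and_integral_of_tendsto_gaussianPrimitive le_rfl (sq_nonneg a)
      (tendsto_gaussianPrimitive_zero_atTop ha)).2
    simp only [contraction, zero_mul, add_zero, sqrt_one, div_one, one_pow] at h
    simpa only [neg_mul, mul_comm (a ^ 2)] using h

lemma exp_neg_mul_sq_norm_mul_exp {V : Type*} [NormedAddCommGroup V] [InnerProductSpace ℝ V]
    {a b : ℝ} (hab : a + b ≠ 0) (x y : V) :
    rexp (-a * ‖x - y‖ ^ 2) * rexp (-b * ‖y‖ ^ 2) =
      rexp (-(a * b / (a + b)) * ‖x‖ ^ 2) * rexp (-(a + b) * ‖y - (a / (a + b)) • x‖ ^ 2) := by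
  rw [← exp_add, ← exp_add, norm_sub_sq_real, norm_sub_sq_real, inner_smul_right, norm_smul,
    mul_pow, Real.norm_eq_abs, sq_abs, real_inner_comm]
  congr 1
  field_simp
  ring

section Gaussian

variable {V : Type*} [NormedAddCommGroup V] [InnerProductSpace ℝ V] [FiniteDimensional ℝ V]
  [MeasurableSpace V] [BorelSpace V]

lemma integrable_exp_neg_mul_sq_norm {b : ℝ} (hb : 0 < b) :
    Integrable fun y : V ↦ rexp (-b * ‖y‖ ^ 2) := by
  refine Integrable.of_integral_ne_zero ?_
  rw [GaussianFourier.integral_rexp_neg_mul_sq_norm hb]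
  exact (rpow_pos_of_pos (div_pos pi_pos hb) _).ne'

lemma integrable_exp_neg_mul_sq_norm_mul_exp {a b : ℝ} (hab : 0 < a + b) (x : V) :
    Integrable fun y : V ↦ rexp (-a * ‖x - y‖ ^ 2) * rexp (-b * ‖y‖ ^ 2) := by
  simp_rw [exp_neg_mul_sq_norm_mul_exp hab.ne']
  exact ((integrable_exp_neg_mul_sq_norm hab).comp_sub_right _).const_mul _

lemma integral_exp_neg_mul_sq_norm_mul_exp {a b : ℝ} (hab : 0 < a + b) (x : V) :
    ∫ y : V, rexp (-a * ‖x - y‖ ^ 2) * rexp (-b * ‖y‖ ^ 2) =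
      rexp (-(a * b / (a + b)) * ‖x‖ ^ 2) * (π / (a + b)) ^ (Module.finrank ℝ V / 2 : ℝ) := by
  simp_rw [exp_neg_mul_sq_norm_mul_exp hab.ne']
  rw [integral_const_mul, integral_sub_right_eq_self (fun y : V ↦ rexp (-(a + b) * ‖y‖ ^ 2)),
    GaussianFourier.integral_rexp_neg_mul_sq_norm hab]

/-- Swapping the Gaussian average with the integral over scales that represents the norm. -/
lemma integral_norm_sub_mul_exp {b : ℝ} (hb : 0 < b) (x : V)
    (hint : IntegrableOn (fun s : ℝ ↦
      ∫ y : V, (1 - rexp (-s ^ 2 * ‖x - y‖ ^ 2)) / s ^ 2 * rexp (-b * ‖y‖ ^ 2)) (Ioi 0)) :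
    √π * ∫ y : V, ‖x - y‖ * rexp (-b * ‖y‖ ^ 2) =
      ∫ s in Ioi (0 : ℝ),
        ∫ y : V, (1 - rexp (-s ^ 2 * ‖x - y‖ ^ 2)) / s ^ 2 * rexp (-b * ‖y‖ ^ 2) := by
  have hnonneg (s : ℝ) (y : V) :
      0 ≤ (1 - rexp (-s ^ 2 * ‖x - y‖ ^ 2)) / s ^ 2 * rexp (-b * ‖y‖ ^ 2) := by
    refine mul_nonneg (div_nonneg (sub_nonneg.2 (exp_le_one_iff.2 ?_)) (sq_nonneg s))
      (exp_pos _).le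
    nlinarith [mul_nonneg (sq_nonneg s) (sq_nonneg ‖x - y‖)]
  rw [← integral_const_mul, ← integral_integral_swap]
  · refine integral_congr_ae (.of_forall fun y ↦ ?_)
    simp only
    rw [integral_mul_const, integral_one_sub_exp_div_sq (norm_nonneg _)]
    ring
  · refine (integrable_prod_iff' ?_).2 ⟨.of_forall fun s ↦ ?_, ?_⟩
    · refine Measurable.aestronglyMeasurable ?_
      simp only [Function.uncurry_def]
      fun_prop
    · have h := ((integrable_exp_neg_mul_sq_norm (V := V) hb).sub
        (integrable_exp_neg_mul_sq_norm_mul_exp (a := s ^ 2) (by positivity) x)).const_mul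
          (s ^ 2)⁻¹
      refine h.congr (.of_forall fun y ↦ ?_)
      simp only [Function.uncurry_apply_pair, Pi.sub_apply]
      ring
    · simpa only [Function.uncurry_apply_pair, Real.norm_of_nonneg (hnonneg _ _), IntegrableOn] using hint

end Gaussian

lemma rpow_three_halves_eq_sqrt_pow {t : ℝ} (ht : 0 ≤ t) : t ^ ((3 : ℝ) / 2) = √t ^ 3 := by
  rw [sqrt_eq_rpow, ← rpow_natCast, ← rpow_mul ht]
  norm_num

lemma integral_one_sub_exp_div_sq_mul_exp {c : ℝ} (hc : 0 < c) (x : EuclideanSpace ℝ (Fin 3))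
    (s : ℝ) :
    ∫ y : EuclideanSpace ℝ (Fin 3),
        (1 - rexp (-s ^ 2 * ‖x - y‖ ^ 2)) / s ^ 2 * rexp (-c⁻¹ * ‖y‖ ^ 2) =
      √(π * c) ^ 3 *
        ((1 - rexp (-‖x‖ ^ 2 * contraction c s ^ 2) / √(1 + c * s ^ 2) ^ 3) / s ^ 2) := by
  have hci : 0 < c⁻¹ := inv_pos.2 hc
  have hab : 0 < s ^ 2 + c⁻¹ := by positivity
  have h1 := one_add_mul_sq_pos hc.le s
  have hsplit (y : EuclideanSpace ℝ (Fin 3)) :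
      (1 - rexp (-s ^ 2 * ‖x - y‖ ^ 2)) / s ^ 2 * rexp (-c⁻¹ * ‖y‖ ^ 2) =
      (s ^ 2)⁻¹ * (rexp (-c⁻¹ * ‖y‖ ^ 2) -
        rexp (-s ^ 2 * ‖x - y‖ ^ 2) * rexp (-c⁻¹ * ‖y‖ ^ 2)) := by ring
  simp_rw [hsplit]
  rw [integral_const_mul, integral_sub (integrable_exp_neg_mul_sq_norm hci)
    (integrable_exp_neg_mul_sq_norm_mul_exp hab x), integral_exp_neg_mul_sq_norm_mul_exp hab,
    GaussianFourier.integral_rexp_neg_mul_sq_norm hci]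
  have h2 : π / (s ^ 2 + c⁻¹) = π * c / (1 + c * s ^ 2) := by field_simp; ring
  have h3 : -(s ^ 2 * c⁻¹ / (s ^ 2 + c⁻¹)) * ‖x‖ ^ 2 = -‖x‖ ^ 2 * contraction c s ^ 2 := by
    rw [contraction, div_pow, sq_sqrt h1.le]
    field_simp
    ring
  have hfin : ((Module.finrank ℝ (EuclideanSpace ℝ (Fin 3)) : ℝ)) = 3 := by simp
  rw [h2, h3, div_inv_eq_mul, hfin, rpow_three_halves_eq_sqrt_pow (by positivity),
    rpow_three_halves_eq_sqrt_pow (by positivity), sqrt_div (by positivity)]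
  ring

lemma integral_norm_sub_mul_exp_eq {c : ℝ} (hc : 0 < c) (x : EuclideanSpace ℝ (Fin 3)) :
    √π * ∫ y : EuclideanSpace ℝ (Fin 3), ‖x - y‖ * rexp (-c⁻¹ * ‖y‖ ^ 2) =
      √(π * c) ^ 3 * (√c * rexp (-‖x‖ ^ 2 / c) +
        (2 * ‖x‖ ^ 2 + c) * ∫ u in (0 : ℝ)..1 / √c, rexp (-‖x‖ ^ 2 * u ^ 2)) := by
  have h := integrableOn_and_integral_of_tendsto_gaussianPrimitive hc.le (sq_nonneg ‖x‖)
    (tendsto_gaussianPrimitive_atTop_of_pos hc (‖x‖ ^ 2))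
  rw [integral_norm_sub_mul_exp (inv_pos.2 hc)]
  · simp_rw [integral_one_sub_exp_div_sq_mul_exp hc]
    rw [integral_const_mul, h.2]
  · simp_rw [integral_one_sub_exp_div_sq_mul_exp hc]
    exact h.1.const_mul _

lemma integral_exp_neg_sq_mul_sq {r : ℝ} (hr : r ≠ 0) (w : ℝ) :
    ∫ u in (0 : ℝ)..w, rexp (-r ^ 2 * u ^ 2) = √π / (2 * r) * erf (r * w) := by
  have h := intervalIntegral.integral_comp_mul_left (a := 0) (b := w)
    (fun u ↦ rexp (-u ^ 2)) hr
  simp only [mul_pow, mul_zero, smul_eq_mul, ← neg_mul] at h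
  have hpi : √π ≠ 0 := (sqrt_pos.2 pi_pos).ne'
  rw [h, erf]
  field_simp

/-- The biharmonic potential of a centered isotropic Gaussian in ℝ³:
`∫ (|x−y|/(8π)) ρ(y) dy = (1/(8π))[σ√(2/π) e^{−r²/(2σ²)} + erf(r/(√2 σ))(σ²/r + r)]`
with `r = |x|`. -/
theorem stmt_15 (σ : ℝ) (hσ : 0 < σ)
    (ρ : EuclideanSpace ℝ (Fin 3) → ℝ)
    (hρ : ∀ y, ρ y = (1 / (σ ^ 3 * (2 * Real.pi) ^ ((3 : ℝ) / 2))) *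
      Real.exp (-‖y‖ ^ 2 / (2 * σ ^ 2)))
    (x : EuclideanSpace ℝ (Fin 3)) (hx : x ≠ 0) :
    ∫ y, (‖x - y‖ / (8 * Real.pi)) * ρ y =
      (1 / (8 * Real.pi)) *
        (σ * Real.sqrt (2 / Real.pi) * Real.exp (-‖x‖ ^ 2 / (2 * σ ^ 2)) +
          erf (‖x‖ / (Real.sqrt 2 * σ)) * (σ ^ 2 / ‖x‖ + ‖x‖)) := by
  have hc : 0 < 2 * σ ^ 2 := by positivity
  have hr : ‖x‖ ≠ 0 := norm_ne_zero_iff.2 hx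
  have key := integral_norm_sub_mul_exp_eq hc x
  rw [integral_exp_neg_sq_mul_sq hr, sqrt_mul zero_le_two, sqrt_sq hσ.le, mul_one_div] at key
  have hL (y : EuclideanSpace ℝ (Fin 3)) : (‖x - y‖ / (8 * π)) * ρ y =
      1 / (8 * π) * (1 / (σ ^ 3 * (2 * π) ^ ((3 : ℝ) / 2))) *
        (‖x - y‖ * rexp (-(2 * σ ^ 2)⁻¹ * ‖y‖ ^ 2)) := by
    rw [hρ, show -‖y‖ ^ 2 / (2 * σ ^ 2) = -(2 * σ ^ 2)⁻¹ * ‖y‖ ^ 2 by ring]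
    ring
  have hs : √(π * (2 * σ ^ 2)) = √π * √2 * σ := by
    rw [sqrt_mul pi_pos.le, sqrt_mul zero_le_two, sqrt_sq hσ.le, mul_assoc]
  simp_rw [hL]
  rw [integral_const_mul, rpow_three_halves_eq_sqrt_pow (by positivity), sqrt_mul zero_le_two,
    sqrt_div zero_le_two]
  rw [hs] at key
  have hpi : 0 < √π := sqrt_pos.2 pi_pos
  have h2 : 0 < √(2 : ℝ) := sqrt_pos.2 two_pos
  rw [mul_assoc]
  congr 1
  rw [← mul_right_inj' hpi.ne', mul_left_comm, key]
  generalize rexp (-‖x‖ ^ 2 / (2 * σ ^ 2)) = E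
  generalize erf (‖x‖ / (√2 * σ)) = F
  field_simp
  ring
end

section
/- Let σ > 0 and let ρ : ℝ² → ℝ be the Gaussian ρ(y) = (1/(2πσ²)) e^{−|y|²/(2σ²)}. Then for every x ∈ ℝ² with x ≠ 0, writing r = |x|, the logarithmic potential of ρ satisfies ∫_{ℝ²} (−(1/(2π)) log|x−y|) ρ(y) dy = −(1/(4π)) [ E₁(r²/(2σ²)) + log(r²) ], where E₁ is the exponential integral E₁(t) = ∫_t^∞ (e^{−u}/u) du. -/
open MeasureTheory

/-- The exponential integral `E₁(t) = ∫_t^∞ (e^{−u}/u) du`. -/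
noncomputable def expIntE1 (t : ℝ) : ℝ :=
  ∫ u in Set.Ioi t, Real.exp (-u) / u

section GaussianLogPotential

open Real Set Filter Topology

/-- A logarithm is dominated by `r + r⁻¹`. -/
lemma abs_log_le_add_inv {r : ℝ} (hr : 0 < r) : |log r| ≤ r + r⁻¹ := by
  have h1 := log_le_self hr.le
  have h2 := log_le_self (inv_pos.2 hr).le
  rw [log_inv] at h2
  have h3 := inv_pos.2 hr
  exact abs_le.2 ⟨by linarith, by linarith⟩

lemma integrableOn_mul_exp_neg_mul_sq {b : ℝ} (hb : 0 < b) :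
    IntegrableOn (fun r : ℝ ↦ r * exp (-b * r ^ 2)) (Ioi 0) := by
  simpa using integrableOn_rpow_mul_exp_neg_mul_sq hb (by norm_num : (-1 : ℝ) < 1)

lemma integrableOn_mul_exp_neg_mul_sq_mul_log {b : ℝ} (hb : 0 < b) :
    IntegrableOn (fun r : ℝ ↦ r * exp (-b * r ^ 2) * log r) (Ioi 0) := by
  have h0 : IntegrableOn (fun r : ℝ ↦ exp (-b * r ^ 2)) (Ioi 0) :=
    (integrable_exp_neg_mul_sq hb).integrableOn
  have h2 : IntegrableOn (fun r : ℝ ↦ r ^ 2 * exp (-b * r ^ 2)) (Ioi 0) := by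
    simpa using integrableOn_rpow_mul_exp_neg_mul_sq hb (by norm_num : (-1 : ℝ) < 2)
  refine Integrable.mono' (h2.add h0) (by fun_prop) ?_
  filter_upwards [ae_restrict_mem measurableSet_Ioi] with r hr
  have hr : 0 < r := hr
  have he := exp_pos (-b * r ^ 2)
  rw [norm_eq_abs, abs_mul, abs_of_pos (mul_pos hr he)]
  calc r * exp (-b * r ^ 2) * |log r| ≤ r * exp (-b * r ^ 2) * (r + r⁻¹) := by
        gcongr; exact abs_log_le_add_inv hr
    _ = _ := by simp only [Pi.add_apply]; field_simp

lemma integrableOn_exp_neg_mul_sq_div {b R : ℝ} (hb : 0 < b) (hR : 0 < R) :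
    IntegrableOn (fun r : ℝ ↦ exp (-b * r ^ 2) / r) (Ioi R) := by
  have h0 : IntegrableOn (fun r : ℝ ↦ exp (-b * r ^ 2) / R) (Ioi R) :=
    ((integrable_exp_neg_mul_sq hb).div_const R).integrableOn
  refine Integrable.mono' h0 (Measurable.aestronglyMeasurable (by fun_prop)) ?_
  filter_upwards [ae_restrict_mem measurableSet_Ioi] with r hr
  have hr : R < r := hr
  have hr0 : 0 < r := hR.trans hr
  rw [norm_eq_abs, abs_of_pos (by positivity)]
  gcongr

/-- The substitution `u = b r²` in the exponential integral. -/
lemma expIntE1_mul_sq {b R : ℝ} (hb : 0 < b) (hR : 0 < R) :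
    expIntE1 (b * R ^ 2) = 2 * ∫ r in Ioi R, exp (-b * r ^ 2) / r := by
  have himg : (fun r : ℝ ↦ b * r ^ 2) '' Ioi R = Ioi (b * R ^ 2) := by
    ext u
    constructor
    · rintro ⟨r, hr, rfl⟩
      have hr : R < r := hr
      simp only [mem_Ioi]
      gcongr
    · intro hu
      have hu : b * R ^ 2 < u := hu
      refine ⟨√(u / b), ?_, ?_⟩
      · rw [mem_Ioi, lt_sqrt hR.le, lt_div_iff₀ hb]
        linarith
      · have : 0 ≤ u / b := by
          have : 0 < u := lt_trans (by positivity) hu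
          positivity
        simp only [sq_sqrt this]
        field_simp
  have hinj : InjOn (fun r : ℝ ↦ b * r ^ 2) (Ioi R) := by
    intro r hr s hs h
    have hr : 0 < r := hR.trans hr
    have hs : 0 < s := hR.trans hs
    exact (pow_left_inj₀ hr.le hs.le two_ne_zero).1 (mul_left_cancel₀ hb.ne' h)
  have hder : ∀ r ∈ Ioi R, HasDerivWithinAt (fun r : ℝ ↦ b * r ^ 2) (2 * b * r) (Ioi R) r := by
    intro r _
    refine HasDerivAt.hasDerivWithinAt ?_
    convert! (hasDerivAt_pow 2 r).const_mul b using 1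
    push_cast
    ring
  rw [expIntE1, ← himg, integral_image_eq_integral_abs_deriv_smul measurableSet_Ioi hder hinj,
    ← integral_const_mul]
  refine setIntegral_congr_fun measurableSet_Ioi fun r hr ↦ ?_
  have hr : 0 < r := hR.trans hr
  simp only [smul_eq_mul]
  rw [abs_of_pos (by positivity), neg_mul]
  field_simp

lemma hasDerivAt_exp_neg_mul_sq {b : ℝ} (hb : 0 < b) (r : ℝ) :
    HasDerivAt (fun r : ℝ ↦ -(exp (-b * r ^ 2) / (2 * b))) (r * exp (-b * r ^ 2)) r := by
  convert! ((((hasDerivAt_pow 2 r).const_mul (-b)).exp).div_const (2 * b)).neg using 1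
  push_cast
  field_simp

lemma integral_Ioc_mul_exp_neg_mul_sq {b R : ℝ} (hb : 0 < b) (hR : 0 < R) :
    ∫ r in Ioc 0 R, r * exp (-b * r ^ 2) = (1 - exp (-b * R ^ 2)) / (2 * b) := by
  rw [← intervalIntegral.integral_of_le hR.le,
    intervalIntegral.integral_eq_sub_of_hasDerivAt (fun r _ ↦ hasDerivAt_exp_neg_mul_sq hb r)
      (Continuous.intervalIntegrable (by fun_prop) _ _)]
  simp
  ring

lemma integral_Ioi_mul_exp_neg_mul_sq_mul_log {b R : ℝ} (hb : 0 < b) (hR : 0 < R) :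
    ∫ r in Ioi R, r * exp (-b * r ^ 2) * log r =
      (exp (-b * R ^ 2) * log R + expIntE1 (b * R ^ 2) / 2) / (2 * b) := by
  have hI1 : IntegrableOn (fun r : ℝ ↦ r * exp (-b * r ^ 2) * log r) (Ioi R) :=
    (integrableOn_mul_exp_neg_mul_sq_mul_log hb).mono_set (Ioi_subset_Ioi hR.le)
  have hI2 := (integrableOn_exp_neg_mul_sq_div hb hR).div_const (2 * b)
  have hder : ∀ r ∈ Ici R, HasDerivAt (fun r : ℝ ↦ -(exp (-b * r ^ 2) / (2 * b)) * log r)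
      (r * exp (-b * r ^ 2) * log r - exp (-b * r ^ 2) / r / (2 * b)) r := by
    intro r hr
    have hr : 0 < r := hR.trans_le hr
    convert! (hasDerivAt_exp_neg_mul_sq hb r).mul (hasDerivAt_log hr.ne') using 1
    field_simp
    ring
  have hlim : Tendsto (fun r : ℝ ↦ -(exp (-b * r ^ 2) / (2 * b)) * log r) atTop (𝓝 0) := by
    have h1 : Tendsto (fun r : ℝ ↦ r ^ (1 : ℝ) * exp (-b * r ^ 2)) atTop (𝓝 0) :=
      (rpow_mul_exp_neg_mul_sq_isLittleO_exp_neg hb 1).tendsto_zero_of_tendsto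
        (tendsto_exp_atBot.comp (tendsto_id.const_mul_atTop_of_neg (by norm_num)))
    have h2 := h1.div_const (2 * b)
    rw [zero_div] at h2
    refine squeeze_zero_norm' ?_ h2
    filter_upwards [eventually_ge_atTop 1] with r hr
    have hl := log_nonneg hr
    rw [norm_eq_abs, abs_mul, abs_neg, abs_of_pos (by positivity), abs_of_nonneg hl, rpow_one]
    have := log_le_self (zero_le_one.trans hr)
    calc exp (-b * r ^ 2) / (2 * b) * log r ≤ exp (-b * r ^ 2) / (2 * b) * r := by gcongr
      _ = _ := by ring
  have key := integral_Ioi_of_hasDerivAt_of_tendsto' hder (hI1.sub hI2) hlim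
  rw [integral_sub hI1 hI2, integral_div] at key
  rw [expIntE1_mul_sq hb hR]
  linear_combination key

lemma log_add_posLog_inv_mul {r R : ℝ} (hr : 0 < r) (hR : 0 < R) :
    log r + log⁺ (r⁻¹ * R) = max (log r) (log R) := by
  rw [posLog, log_mul (inv_pos.2 hr).ne' hR.ne', log_inv, ← max_add_add_left]
  simp

lemma integral_Ioi_mul_exp_neg_mul_sq_mul_max_log {b R : ℝ} (hb : 0 < b) (hR : 0 < R) :
    ∫ r in Ioi 0, r * exp (-b * r ^ 2) * max (log r) (log R) =
      (log R + expIntE1 (b * R ^ 2) / 2) / (2 * b) := by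
  have e1 : EqOn (fun r : ℝ ↦ r * exp (-b * r ^ 2) * max (log r) (log R))
      (fun r : ℝ ↦ r * exp (-b * r ^ 2) * log R) (Ioc 0 R) := by
    intro r hr
    simp only [max_eq_right (log_le_log hr.1 hr.2)]
  have e2 : EqOn (fun r : ℝ ↦ r * exp (-b * r ^ 2) * max (log r) (log R))
      (fun r : ℝ ↦ r * exp (-b * r ^ 2) * log r) (Ioi R) := by
    intro r hr
    simp only [max_eq_left (log_le_log hR (le_of_lt hr))]
  have i1 : IntegrableOn (fun r : ℝ ↦ r * exp (-b * r ^ 2) * log R) (Ioc 0 R) :=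
    ((integrableOn_mul_exp_neg_mul_sq hb).mono_set Ioc_subset_Ioi_self).mul_const _
  have i2 : IntegrableOn (fun r : ℝ ↦ r * exp (-b * r ^ 2) * log r) (Ioi R) :=
    (integrableOn_mul_exp_neg_mul_sq_mul_log hb).mono_set (Ioi_subset_Ioi hR.le)
  rw [← Ioc_union_Ioi_eq_Ioi hR.le, setIntegral_union Ioc_disjoint_Ioi_same measurableSet_Ioi
    (i1.congr_fun e1.symm measurableSet_Ioc) (i2.congr_fun e2.symm measurableSet_Ioi),
    setIntegral_congr_fun measurableSet_Ioc e1, setIntegral_congr_fun measurableSet_Ioi e2,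
    integral_mul_const, integral_Ioc_mul_exp_neg_mul_sq hb hR,
    integral_Ioi_mul_exp_neg_mul_sq_mul_log hb hR]
  ring

/-- The logarithmic kernel is integrable against a Gaussian on the plane. -/
lemma integrable_log_norm_sub_mul_exp_neg_mul_sq {b : ℝ} (hb : 0 < b) (a : ℂ) :
    Integrable (fun z : ℂ ↦ log ‖z - a‖ * exp (-b * ‖z‖ ^ 2)) := by
  have h1 : Integrable (fun z : ℂ ↦ exp (-(b / 2) * ‖z‖ ^ 2) * log ‖z‖) := by
    refine (integrable_fun_norm_addHaar volume
      (f := fun r : ℝ ↦ exp (-(b / 2) * r ^ 2) * log r)).2 ?_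
    simpa [Complex.finrank_real_complex, mul_assoc] using
      integrableOn_mul_exp_neg_mul_sq_mul_log (half_pos hb)
  have h2 := (h1.comp_sub_right a).norm.const_mul (exp (b * ‖a‖ ^ 2))
  refine Integrable.mono' h2 (Measurable.aestronglyMeasurable (by fun_prop)) (ae_of_all _ ?_)
  intro z
  rw [norm_mul, norm_mul, norm_of_nonneg (exp_pos _).le, norm_of_nonneg (exp_pos _).le,
    ← mul_assoc, ← exp_add, mul_comm]
  gcongr
  have h3 : ‖z - a‖ ^ 2 ≤ 2 * (‖z‖ ^ 2 + ‖a‖ ^ 2) := by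
    have := norm_sub_le z a
    nlinarith [sq_nonneg (‖z‖ - ‖a‖), norm_nonneg (z - a), norm_nonneg z, norm_nonneg a]
  nlinarith

/-- Integrability in polar coordinates. -/
lemma MeasureTheory.Integrable.comp_complex_polarCoord_symm {f : ℂ → ℝ} (hf : Integrable f)
    (hm : Measurable f) :
    IntegrableOn (fun p : ℝ × ℝ ↦ p.1 * f (Complex.polarCoord.symm p)) polarCoord.target := by
  have hs : Measurable (fun p : ℝ × ℝ ↦ Complex.polarCoord.symm p) := by
    simp only [Complex.polarCoord_symm_apply]
    fun_prop
  refine ⟨(measurable_fst.mul (hm.comp hs)).aestronglyMeasurable, ?_⟩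
  have h := hf.2
  rw [HasFiniteIntegral, ← Complex.lintegral_comp_polarCoord_symm] at h
  rw [HasFiniteIntegral]
  refine lt_of_eq_of_lt (setLIntegral_congr_fun polarCoord.open_target.measurableSet ?_) h
  intro p hp
  have hp : 0 < p.1 := hp.1
  simp only [enorm_mul, smul_eq_mul, Real.enorm_eq_ofReal hp.le]

/-- The mean value of the logarithmic kernel over a circle centred at the origin. -/
lemma integral_Ioo_log_norm_polarCoord_symm_sub {r : ℝ} (hr : 0 < r) {a : ℂ} (ha : a ≠ 0) :
    ∫ θ in Ioo (-π) π, log ‖Complex.polarCoord.symm (r, θ) - a‖ =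
      2 * π * max (log r) (log ‖a‖) := by
  have h := circleAverage_log_norm_sub_const_eq_log_radius_add_posLog (a := a) (c := 0) hr.ne'
  rw [zero_sub, norm_neg, log_add_posLog_inv_mul hr (norm_pos_iff.2 ha),
    circleAverage_eq_integral_add (-π), intervalIntegral.integral_comp_add_right
      (fun θ ↦ log ‖circleMap 0 r θ - a‖), smul_eq_mul] at h
  rw [← h, ← integral_Ioc_eq_integral_Ioo, ← intervalIntegral.integral_of_le (by linarith [pi_pos]),
    mul_inv_cancel_left₀ (by positivity)]
  rw [show (0 : ℝ) + -π = -π by ring, show 2 * π + -π = π by ring]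
  refine intervalIntegral.integral_congr fun θ _ ↦ ?_
  simp [circleMap, Complex.exp_mul_I]

lemma integral_log_norm_sub_mul_exp_neg_mul_sq {b : ℝ} (hb : 0 < b) {a : ℂ} (ha : a ≠ 0) :
    ∫ z : ℂ, log ‖z - a‖ * exp (-b * ‖z‖ ^ 2) =
      π / b * (log ‖a‖ + expIntE1 (b * ‖a‖ ^ 2) / 2) := by
  have hint := (integrable_log_norm_sub_mul_exp_neg_mul_sq hb a).comp_complex_polarCoord_symm
    (by fun_prop)
  have htgt : polarCoord.target = Ioi (0 : ℝ) ×ˢ Ioo (-π) π := rfl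
  rw [← Complex.integral_comp_polarCoord_symm]
  simp only [smul_eq_mul]
  rw [htgt] at hint ⊢
  rw [Measure.volume_eq_prod] at hint ⊢
  rw [setIntegral_prod _ hint]
  calc _ = ∫ r in Ioi (0 : ℝ), 2 * π * (r * exp (-b * r ^ 2) * max (log r) (log ‖a‖)) := by
        refine setIntegral_congr_fun measurableSet_Ioi fun r hr ↦ ?_
        simp only [Complex.norm_polarCoord_symm, sq_abs]
        rw [integral_const_mul, integral_mul_const, integral_Ioo_log_norm_polarCoord_symm_sub hr ha]
        ring
    _ = _ := by
        rw [integral_const_mul,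
          integral_Ioi_mul_exp_neg_mul_sq_mul_max_log hb (norm_pos_iff.2 ha)]
        field_simp

end GaussianLogPotential

/-- The logarithmic potential of a centered isotropic Gaussian in ℝ²:
`∫ (−(1/2π) log|x−y|) ρ(y) dy = −(1/(4π))[E₁(r²/(2σ²)) + log(r²)]` with `r = |x|`. -/
theorem stmt_16 (σ : ℝ) (hσ : 0 < σ)
    (ρ : EuclideanSpace ℝ (Fin 2) → ℝ)
    (hρ : ∀ y, ρ y = (1 / (2 * Real.pi * σ ^ 2)) * Real.exp (-‖y‖ ^ 2 / (2 * σ ^ 2)))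
    (x : EuclideanSpace ℝ (Fin 2)) (hx : x ≠ 0) :
    ∫ y, (-(1 / (2 * Real.pi)) * Real.log ‖x - y‖) * ρ y =
      -(1 / (4 * Real.pi)) * (expIntE1 (‖x‖ ^ 2 / (2 * σ ^ 2)) + Real.log (‖x‖ ^ 2)) := by
  let e := Complex.orthonormalBasisOneI.repr
  have hb : 0 < 1 / (2 * σ ^ 2) := by positivity
  have hx' : e.symm x ≠ 0 := by simpa using hx
  have h := integral_log_norm_sub_mul_exp_neg_mul_sq hb hx'
  rw [e.symm.norm_map, one_div_mul_eq_div] at h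
  have he : MeasurePreserving e volume volume := e.measurePreserving
  rw [← he.integral_comp e.toHomeomorph.measurableEmbedding]
  calc _ = ∫ z : ℂ, -(1 / (2 * Real.pi)) * (1 / (2 * Real.pi * σ ^ 2)) *
        (Real.log ‖z - e.symm x‖ * Real.exp (-(1 / (2 * σ ^ 2)) * ‖z‖ ^ 2)) := by
        congr 1 with z
        have h1 : ‖x - e z‖ = ‖z - e.symm x‖ := by
          rw [← e.norm_map (z - e.symm x), map_sub, e.apply_symm_apply, norm_sub_rev]
        rw [hρ, h1, e.norm_map]
        ring_nf
    _ = _ := by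
        rw [integral_const_mul, h, Real.log_pow]
        have := Real.pi_pos
        push_cast
        field_simp
        ring
end

section
/- Let k > 0 and let f : ℝ³ → ℂ be smooth with compact support. Define the Helmholtz volume potential φ(x) = ∫_{ℝ³} (e^{ik|x−y|}/(4π|x−y|)) f(y) dy. Then φ is twice continuously differentiable and satisfies Δφ(x) + k² φ(x) = −f(x) for every x ∈ ℝ³. -/
open MeasureTheory

/-- The Laplacian of a complex-valued function on ℝ³: the sum of its second partial
derivatives along the coordinate directions (equivalently, the Laplacian applied to the
real and imaginary parts). -/
noncomputable def laplacianC (φ : EuclideanSpace ℝ (Fin 3) → ℂ)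
    (x : EuclideanSpace ℝ (Fin 3)) : ℂ :=
  ∑ i : Fin 3,
    fderiv ℝ (fun y => fderiv ℝ φ y (EuclideanSpace.single i 1)) x (EuclideanSpace.single i 1)

open Filter Topology

/-- Partial derivative along the `i`-th coordinate direction of `ℝ³`. -/
noncomputable def partialC (i : Fin 3) (g : EuclideanSpace ℝ (Fin 3) → ℂ)
    (x : EuclideanSpace ℝ (Fin 3)) : ℂ :=
  fderiv ℝ g x (EuclideanSpace.single i 1)

lemma laplacianC_eq_sum (g : EuclideanSpace ℝ (Fin 3) → ℂ) (x : EuclideanSpace ℝ (Fin 3)) :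
    laplacianC g x = ∑ i, partialC i (partialC i g) x := rfl

lemma contDiff_partialC {n m : ℕ∞} {g : EuclideanSpace ℝ (Fin 3) → ℂ} (hg : ContDiff ℝ n g)
    (hmn : m + 1 ≤ n) (i : Fin 3) : ContDiff ℝ m (partialC i g) :=
  (hg.fderiv_right (by exact_mod_cast hmn)).clm_apply contDiff_const

lemma hasCompactSupport_partialC {g : EuclideanSpace ℝ (Fin 3) → ℂ} (hg : HasCompactSupport g)
    (i : Fin 3) : HasCompactSupport (partialC i g) :=
  hg.fderiv_apply (𝕜 := ℝ) _

lemma integral_mul_partialC {u g : EuclideanSpace ℝ (Fin 3) → ℂ} (hu : ContDiff ℝ 1 u)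
    (hg : ContDiff ℝ 1 g) (hc : HasCompactSupport g) (i : Fin 3) :
    ∫ x, u x * partialC i g x = - ∫ x, partialC i u x * g x := by
  have hu' : ContDiff ℝ 0 (partialC i u) := contDiff_partialC (n := 1) (m := 0) hu (by simp) i
  have hg' : ContDiff ℝ 0 (partialC i g) := contDiff_partialC (n := 1) (m := 0) hg (by simp) i
  refine integral_mul_fderiv_eq_neg_fderiv_mul_of_integrable ?_ ?_ ?_
    (fun x _ => hu.differentiable one_ne_zero x) (fun x _ => hg.differentiable one_ne_zero x)
  · exact (hu'.continuous.mul hg.continuous).integrable_of_hasCompactSupport hc.mul_left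
  · exact (hu.continuous.mul hg'.continuous).integrable_of_hasCompactSupport
      (hasCompactSupport_partialC hc i).mul_left
  · exact (hu.continuous.mul hg.continuous).integrable_of_hasCompactSupport hc.mul_left

/-- Green's second identity for a compactly supported function. -/
lemma integral_mul_laplacianC {u g : EuclideanSpace ℝ (Fin 3) → ℂ} (hu : ContDiff ℝ 2 u)
    (hg : ContDiff ℝ 2 g) (hc : HasCompactSupport g) :
    ∫ x, u x * laplacianC g x = ∫ x, laplacianC u x * g x := by
  have hu1 i : ContDiff ℝ 1 (partialC i u) :=
    contDiff_partialC (n := 2) (m := 1) hu (by norm_num) i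
  have hg1 i : ContDiff ℝ 1 (partialC i g) :=
    contDiff_partialC (n := 2) (m := 1) hg (by norm_num) i
  have hu2 i : ContDiff ℝ 0 (partialC i (partialC i u)) :=
    contDiff_partialC (n := 1) (m := 0) (hu1 i) (by simp) i
  have hg2 i : ContDiff ℝ 0 (partialC i (partialC i g)) :=
    contDiff_partialC (n := 1) (m := 0) (hg1 i) (by simp) i
  simp only [laplacianC_eq_sum, Finset.mul_sum, Finset.sum_mul]
  rw [integral_finsetSum, integral_finsetSum]
  · refine Finset.sum_congr rfl fun i _ => ?_
    rw [integral_mul_partialC (hu.of_le (by norm_num)) (hg1 i) (hasCompactSupport_partialC hc i),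
      integral_mul_partialC (hu1 i) (hg.of_le (by norm_num)) hc, neg_neg]
  · exact fun i _ => ((hu2 i).continuous.mul hg.continuous).integrable_of_hasCompactSupport
      hc.mul_left
  · exact fun i _ => (hu.continuous.mul (hg2 i).continuous).integrable_of_hasCompactSupport
      (hasCompactSupport_partialC (hasCompactSupport_partialC hc i) i).mul_left

lemma continuous_laplacianC {g : EuclideanSpace ℝ (Fin 3) → ℂ} (hg : ContDiff ℝ 2 g) :
    Continuous (laplacianC g) := by
  have h i : ContDiff ℝ 0 (partialC i (partialC i g)) :=
    contDiff_partialC (n := 1) (m := 0)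
      (contDiff_partialC (n := 2) (m := 1) hg (by norm_num) i) (by simp) i
  have : laplacianC g = fun x => ∑ i, partialC i (partialC i g) x := rfl
  rw [this]
  exact continuous_finsetSum _ fun i _ => (h i).continuous

lemma hasCompactSupport_laplacianC {g : EuclideanSpace ℝ (Fin 3) → ℂ} (hc : HasCompactSupport g) :
    HasCompactSupport (laplacianC g) := by
  have h i := hasCompactSupport_partialC (hasCompactSupport_partialC hc i) i
  have : laplacianC g = partialC 0 (partialC 0 g) + partialC 1 (partialC 1 g)
      + partialC 2 (partialC 2 g) := by
    ext x; simp [laplacianC_eq_sum, Fin.sum_univ_three]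
  rw [this]
  exact ((h 0).add (h 1)).add (h 2)

lemma partialC_comp_const_sub (g : EuclideanSpace ℝ (Fin 3) → ℂ) (a x : EuclideanSpace ℝ (Fin 3))
    (i : Fin 3) : partialC i (fun y => g (a - y)) x = - partialC i g (a - x) := by
  have : (fun y => g (a - y)) = fun y => (fun z => g (-z)) (y - a) := by
    ext y; simp
  have hneg := fderiv_comp_smul (𝕜 := ℝ) (f := g) (x := x - a) (-1)
  simp only [neg_smul, one_smul, neg_sub] at hneg
  rw [partialC, this, fderiv_comp_sub (f := fun z => g (-z)), hneg]
  simp [partialC]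

lemma laplacianC_comp_const_sub (g : EuclideanSpace ℝ (Fin 3) → ℂ)
    (a x : EuclideanSpace ℝ (Fin 3)) :
    laplacianC (fun y => g (a - y)) x = laplacianC g (a - x) := by
  simp only [laplacianC_eq_sum]
  refine Finset.sum_congr rfl fun i _ => ?_
  have : partialC i (fun y => g (a - y)) = fun y => (fun z => - partialC i g z) (a - y) := by
    ext y; exact partialC_comp_const_sub g a y i
  rw [this, partialC_comp_const_sub (fun z => - partialC i g z)]
  simp only [partialC, fderiv_fun_neg, neg_apply, neg_neg]
  rfl

/-- The outgoing Helmholtz Green's function as a function of the radius. -/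
noncomputable def greenRadial (k t : ℝ) : ℂ :=
  Complex.exp (Complex.I * (k : ℂ) * (t : ℂ)) / ((4 * Real.pi * t : ℝ) : ℂ)

/-- `t⁻¹ * d/dt` applied to `greenRadial k`. -/
noncomputable def greenRadial' (k t : ℝ) : ℂ :=
  Complex.exp (Complex.I * (k : ℂ) * (t : ℂ)) * (Complex.I * k * t - 1) / (4 * Real.pi * t ^ 3)

/-- `t⁻¹ * d/dt` applied to `greenRadial' k`. -/
noncomputable def greenRadial'' (k t : ℝ) : ℂ :=
  Complex.exp (Complex.I * (k : ℂ) * (t : ℂ)) *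
    (3 - 3 * Complex.I * k * t - k ^ 2 * t ^ 2) / (4 * Real.pi * t ^ 5)

lemma hasDerivAt_exp_mul (k t : ℝ) :
    HasDerivAt (fun t : ℝ => Complex.exp (Complex.I * (k : ℂ) * (t : ℂ)))
      (Complex.exp (Complex.I * (k : ℂ) * (t : ℂ)) * (Complex.I * k)) t := by
  simpa using ((Complex.ofRealCLM.hasDerivAt (x := t)).const_mul (Complex.I * (k : ℂ))).cexp

lemma hasDerivAt_greenRadial (k : ℝ) {t : ℝ} (ht : 0 < t) :
    HasDerivAt (greenRadial k) (t * greenRadial' k t) t := by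
  have h0 : (t : ℂ) ≠ 0 := by exact_mod_cast ht.ne'
  have hpi : (Real.pi : ℂ) ≠ 0 := by exact_mod_cast Real.pi_ne_zero
  have hd : HasDerivAt (fun t : ℝ => ((4 * Real.pi * t : ℝ) : ℂ)) (4 * Real.pi) t := by
    simpa using (Complex.ofRealCLM.hasDerivAt (x := t)).const_mul (4 * Real.pi : ℂ)
  refine ((hasDerivAt_exp_mul k t).div hd ?_).congr_deriv ?_
  · simp [h0, hpi]
  · simp only [greenRadial']
    push_cast
    field_simp

lemma hasDerivAt_greenRadial' (k : ℝ) {t : ℝ} (ht : 0 < t) :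
    HasDerivAt (greenRadial' k) (t * greenRadial'' k t) t := by
  have h0 : (t : ℂ) ≠ 0 := by exact_mod_cast ht.ne'
  have hpi : (Real.pi : ℂ) ≠ 0 := by exact_mod_cast Real.pi_ne_zero
  have hid : HasDerivAt (fun t : ℝ => (t : ℂ)) 1 t := HasDerivAt.ofReal_comp (hasDerivAt_id t)
  have hd : HasDerivAt (fun t : ℝ => (4 * Real.pi * t ^ 3 : ℂ)) (4 * Real.pi * (3 * t ^ 2)) t := by
    simpa using (hid.pow 3).const_mul (4 * Real.pi : ℂ)
  have hn := (hasDerivAt_exp_mul k t).fun_mul ((hid.const_mul (Complex.I * k)).sub_const 1)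
  refine (hn.div hd ?_).congr_deriv ?_
  · simp [h0, hpi]
  · simp only [greenRadial'']
    field_simp
    ring_nf
    simp only [Complex.I_sq]
    ring

lemma greenRadial_identity (k ε : ℝ) {t : ℝ} (ht : 0 < t) :
    greenRadial'' k t * (t ^ 2 - ε ^ 2) + 3 * greenRadial' k t + k ^ 2 * greenRadial k t
      = - (ε ^ 2 * greenRadial'' k t) := by
  have h0 : (t : ℂ) ≠ 0 := by exact_mod_cast ht.ne'
  have hpi : (Real.pi : ℂ) ≠ 0 := by exact_mod_cast Real.pi_ne_zero
  simp only [greenRadial'', greenRadial', greenRadial]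
  push_cast
  field_simp
  ring

lemma sqrt_add_norm_sq_pos {ε : ℝ} (hε : 0 < ε) (z : EuclideanSpace ℝ (Fin 3)) :
    0 < √(ε ^ 2 + ‖z‖ ^ 2) := by positivity

lemma hasFDerivAt_radial {ε : ℝ} (hε : 0 < ε) {N P : ℝ → ℂ}
    (hN : ∀ t, 0 < t → HasDerivAt N (t * P t) t) (z : EuclideanSpace ℝ (Fin 3)) :
    HasFDerivAt (fun z : EuclideanSpace ℝ (Fin 3) => N √(ε ^ 2 + ‖z‖ ^ 2))
      ((innerSL ℝ z).smulRight (P √(ε ^ 2 + ‖z‖ ^ 2))) z := by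
  have hs := sqrt_add_norm_sq_pos hε z
  have h1 : HasFDerivAt (fun z : EuclideanSpace ℝ (Fin 3) => ε ^ 2 + ‖z‖ ^ 2)
      (2 • innerSL ℝ z) z := by
    simpa using (hasStrictFDerivAt_norm_sq z).hasFDerivAt.const_add (ε ^ 2)
  have h2 := h1.sqrt (by positivity)
  refine ((hN _ hs).hasFDerivAt.comp z h2).congr_fderiv ?_
  ext v
  have : ((√(ε ^ 2 + ‖z‖ ^ 2) : ℝ) : ℂ) ≠ 0 := by exact_mod_cast hs.ne'
  simp
  field_simp

/-- The smooth regularization of the Green's function at scale `ε`. -/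
noncomputable def greenReg (k ε : ℝ) (z : EuclideanSpace ℝ (Fin 3)) : ℂ :=
  greenRadial k √(ε ^ 2 + ‖z‖ ^ 2)

lemma contDiff_greenReg (k : ℝ) {ε : ℝ} (hε : 0 < ε) : ContDiff ℝ 2 (greenReg k ε) := by
  have hs : ContDiff ℝ 2 (fun z : EuclideanSpace ℝ (Fin 3) => √(ε ^ 2 + ‖z‖ ^ 2)) :=
    (contDiff_const.add (contDiff_norm_sq ℝ)).sqrt fun z => by positivity
  have hc : ContDiff ℝ 2 (fun z : EuclideanSpace ℝ (Fin 3) => ((√(ε ^ 2 + ‖z‖ ^ 2) : ℝ) : ℂ)) :=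
    Complex.ofRealCLM.contDiff.comp hs
  unfold greenReg greenRadial
  simp only [div_eq_mul_inv]
  refine ((contDiff_const.mul hc).cexp).mul (ContDiff.inv ?_ fun z => ?_)
  · exact Complex.ofRealCLM.contDiff.comp (contDiff_const.mul hs)
  · have := sqrt_add_norm_sq_pos hε z
    exact_mod_cast (by positivity : 4 * Real.pi * √(ε ^ 2 + ‖z‖ ^ 2) ≠ 0)

lemma laplacianC_greenReg (k : ℝ) {ε : ℝ} (hε : 0 < ε) (z : EuclideanSpace ℝ (Fin 3)) :
    laplacianC (greenReg k ε) z + k ^ 2 * greenReg k ε z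
      = - (ε ^ 2 * greenRadial'' k √(ε ^ 2 + ‖z‖ ^ 2)) := by
  have hs := sqrt_add_norm_sq_pos hε z
  have h1 (i : Fin 3) : partialC i (greenReg k ε)
      = fun z => (z i : ℂ) * greenRadial' k √(ε ^ 2 + ‖z‖ ^ 2) := by
    ext z
    simp only [partialC]
    unfold greenReg
    rw [(hasFDerivAt_radial hε (fun t => hasDerivAt_greenRadial k) z).fderiv]
    simp [EuclideanSpace.inner_single_right]
  have h2 (i : Fin 3) : partialC i (partialC i (greenReg k ε)) z
      = (z i : ℂ) ^ 2 * greenRadial'' k √(ε ^ 2 + ‖z‖ ^ 2)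
        + greenRadial' k √(ε ^ 2 + ‖z‖ ^ 2) := by
    rw [h1]
    have hz : HasFDerivAt (fun z : EuclideanSpace ℝ (Fin 3) => (z i : ℂ))
        (Complex.ofRealCLM.comp (EuclideanSpace.proj i)) z :=
      (Complex.ofRealCLM.comp (EuclideanSpace.proj (𝕜 := ℝ) i)).hasFDerivAt
    simp only [partialC]
    rw [(hz.fun_mul (hasFDerivAt_radial hε (fun t => hasDerivAt_greenRadial' k) z)).fderiv]
    simp [EuclideanSpace.inner_single_right]
    ring
  have hn : ((√(ε ^ 2 + ‖z‖ ^ 2) : ℝ) : ℂ) ^ 2 = ε ^ 2 + ∑ i, (z i : ℂ) ^ 2 := by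
    rw [← Complex.ofReal_pow, Real.sq_sqrt (by positivity), EuclideanSpace.real_norm_sq_eq]
    push_cast; rfl
  rw [← greenRadial_identity k ε hs, hn, laplacianC_eq_sum]
  simp only [h2, Fin.sum_univ_three, greenReg]
  ring

lemma integral_Ioi_sq_div_sqrt :
    ∫ y in Set.Ioi (0 : ℝ), y ^ 2 * (1 / √(1 + y ^ 2) ^ 5) = 1 / 3 := by
  have hlim : Tendsto (fun y : ℝ => y ^ 3 / (3 * √(1 + y ^ 2) ^ 3)) atTop (𝓝 (1 / 3)) := by
    have h1 : Tendsto (fun y : ℝ => √(1 - (1 + y ^ 2)⁻¹) ^ 3 / 3) atTop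
        (𝓝 (√(1 - 0) ^ 3 / 3)) := by
      have : Tendsto (fun y : ℝ => (1 + y ^ 2)⁻¹) atTop (𝓝 0) :=
        tendsto_inv_atTop_zero.comp
          (tendsto_atTop_add_const_left _ _ (tendsto_pow_atTop two_ne_zero))
      exact ((tendsto_const_nhds.sub this).sqrt.pow 3).div_const 3
    have h2 : √(1 - 0) ^ 3 / 3 = (1 / 3 : ℝ) := by simp
    rw [h2] at h1
    refine h1.congr' ?_
    filter_upwards [eventually_gt_atTop 0] with y hy
    have : 1 - (1 + y ^ 2)⁻¹ = y ^ 2 / (1 + y ^ 2) := by field_simp; ring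
    rw [this, Real.sqrt_div (by positivity), Real.sqrt_sq hy.le]
    field_simp
  have hderiv (y : ℝ) : HasDerivAt (fun y : ℝ => y ^ 3 / (3 * √(1 + y ^ 2) ^ 3))
      (y ^ 2 * (1 / √(1 + y ^ 2) ^ 5)) y := by
    have hs : 0 < √(1 + y ^ 2) := by positivity
    have hsq : √(1 + y ^ 2) ^ 2 = 1 + y ^ 2 := Real.sq_sqrt (by positivity)
    have hsd : HasDerivAt (fun y : ℝ => √(1 + y ^ 2)) (y / √(1 + y ^ 2)) y := by
      refine (((hasDerivAt_pow 2 y).const_add 1).sqrt (by positivity)).congr_deriv ?_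
      field_simp
      norm_num
    refine ((hasDerivAt_pow 3 y).fun_div ((hsd.fun_pow 3).const_mul 3) (by positivity)).congr_deriv ?_
    have hy : y ^ 2 = √(1 + y ^ 2) ^ 2 - 1 := by rw [hsq]; ring
    generalize √(1 + y ^ 2) = s at *
    field_simp
    norm_num
    linear_combination (-3 * y ^ 2 * s ^ 2) * hy
  have := integral_Ioi_of_hasDerivAt_of_nonneg' (a := 0) (fun y _ => hderiv y)
    (fun y _ => by positivity) hlim
  simpa using this

lemma integral_one_div_sqrt_pow_five :
    ∫ w : EuclideanSpace ℝ (Fin 3), 1 / √(1 + ‖w‖ ^ 2) ^ 5 = 4 * Real.pi / 3 := by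
  have h := integral_fun_norm_addHaar (volume : Measure (EuclideanSpace ℝ (Fin 3)))
    (fun y => 1 / √(1 + y ^ 2) ^ 5)
  rw [h]
  simp only [finrank_euclideanSpace, Fintype.card_fin, smul_eq_mul, Nat.add_one_sub_one,
    nsmul_eq_mul, integral_Ioi_sq_div_sqrt, Measure.real]
  rw [EuclideanSpace.volume_ball_fin_three, ENNReal.toReal_mul, ENNReal.toReal_ofReal (by positivity)]
  simp
  ring

lemma integrable_one_div_sqrt_pow_five :
    Integrable (fun w : EuclideanSpace ℝ (Fin 3) => 1 / √(1 + ‖w‖ ^ 2) ^ 5) := by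
  refine (integrable_rpow_neg_one_add_norm_sq (E := EuclideanSpace ℝ (Fin 3)) (r := 5)
    (by simp; norm_num)).congr (.of_forall fun w => ?_)
  have ha : 0 ≤ 1 + ‖w‖ ^ 2 := by positivity
  simp only
  generalize 1 + ‖w‖ ^ 2 = a at ha
  rw [Real.sqrt_eq_rpow, ← Real.rpow_natCast, ← Real.rpow_mul ha, neg_div, Real.rpow_neg ha,
    one_div]
  norm_num

lemma norm_greenRadial (k : ℝ) {t : ℝ} (ht : 0 ≤ t) :
    ‖greenRadial k t‖ = (4 * Real.pi * t)⁻¹ := by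
  have h : ‖Complex.exp (Complex.I * (k : ℂ) * (t : ℂ))‖ = 1 := by
    rw [show Complex.I * (k : ℂ) * (t : ℂ) = ((k * t : ℝ) : ℂ) * Complex.I by push_cast; ring,
      Complex.norm_exp_ofReal_mul_I]
  rw [greenRadial, norm_div, h, Complex.norm_real, Real.norm_of_nonneg (by positivity), one_div]

lemma measurable_greenRadial (k : ℝ) : Measurable (greenRadial k) := by
  unfold greenRadial
  fun_prop

lemma locallyIntegrable_green (k : ℝ) :
    LocallyIntegrable (fun z : EuclideanSpace ℝ (Fin 3) => greenRadial k ‖z‖) := by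
  refine locallyIntegrable_of_norm_le_rpow (C := (4 * Real.pi)⁻¹) (α := 1) (by simp) (by simp)
    (.of_forall fun z => ?_) ((measurable_greenRadial k).comp measurable_norm).aestronglyMeasurable
  rw [norm_greenRadial k (norm_nonneg z), Real.rpow_neg_one, mul_inv]

lemma integrable_green_mul (k : ℝ) {F : EuclideanSpace ℝ (Fin 3) → ℂ} (hF : Continuous F)
    (hc : HasCompactSupport F) : Integrable (fun z => greenRadial k ‖z‖ * F z) :=
  (locallyIntegrable_green k).integrable_smul_right_of_hasCompactSupport hF hc

lemma tendsto_integral_greenReg_mul (k : ℝ) {F : EuclideanSpace ℝ (Fin 3) → ℂ} (hF : Continuous F)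
    (hc : HasCompactSupport F) :
    Tendsto (fun ε => ∫ z, greenReg k ε z * F z) (𝓝[>] 0)
      (𝓝 (∫ z, greenRadial k ‖z‖ * F z)) := by
  refine tendsto_integral_filter_of_dominated_convergence (fun z => ‖greenRadial k ‖z‖ * F z‖)
    ?_ ?_ (integrable_green_mul k hF hc).norm ?_
  · filter_upwards [self_mem_nhdsWithin] with ε hε
    exact ((contDiff_greenReg k hε).continuous.mul hF).aestronglyMeasurable
  · filter_upwards with ε
    filter_upwards [Measure.ae_ne volume 0] with z hz
    have hz' : 0 < ‖z‖ := norm_pos_iff.mpr hz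
    rw [norm_mul, norm_mul, greenReg, norm_greenRadial k (by positivity),
      norm_greenRadial k (by positivity)]
    have : ‖z‖ ≤ √(ε ^ 2 + ‖z‖ ^ 2) := Real.le_sqrt_of_sq_le (by nlinarith [sq_nonneg ε])
    gcongr
  · filter_upwards [Measure.ae_ne volume 0] with z hz
    have hz' : 0 < ‖z‖ := norm_pos_iff.mpr hz
    refine Tendsto.mul_const _ ((hasDerivAt_greenRadial k hz').continuousAt.tendsto.comp ?_)
    have : Continuous fun ε : ℝ => √(ε ^ 2 + ‖z‖ ^ 2) := by fun_prop
    refine (this.tendsto' 0 ‖z‖ ?_).mono_left nhdsWithin_le_nhds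
    simp

lemma tendsto_integral_greenRadial''_mul (k : ℝ) {g : EuclideanSpace ℝ (Fin 3) → ℂ}
    (hg : Continuous g) (hc : HasCompactSupport g) :
    Tendsto (fun ε : ℝ => ∫ z, (ε ^ 2 * greenRadial'' k √(ε ^ 2 + ‖z‖ ^ 2)) * g z) (𝓝[>] 0)
      (𝓝 (g 0)) := by
  set H : ℝ → ℂ := fun t => Complex.exp (Complex.I * (k : ℂ) * (t : ℂ)) *
    (3 - 3 * Complex.I * k * t - k ^ 2 * t ^ 2) / (4 * Real.pi) with hH
  have hHc : Continuous H := by unfold H; fun_prop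
  have hpi : (Real.pi : ℂ) ≠ 0 := by exact_mod_cast Real.pi_ne_zero
  obtain ⟨M, hM⟩ : ∃ M, ∀ ε ∈ Set.Icc (0 : ℝ) 1, ∀ z, ‖H √(ε ^ 2 + ‖z‖ ^ 2) * g z‖ ≤ M := by
    have hcont : Continuous fun p : ℝ × EuclideanSpace ℝ (Fin 3) =>
        H √(p.1 ^ 2 + ‖p.2‖ ^ 2) * g p.2 := by fun_prop
    obtain ⟨M, hM⟩ := (isCompact_Icc.prod hc.isCompact).exists_bound_of_continuousOn
      (hcont.continuousOn (s := Set.Icc (0 : ℝ) 1 ×ˢ tsupport g))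
    refine ⟨max M 0, fun ε hε z => ?_⟩
    by_cases hz : z ∈ tsupport g
    · exact (hM (ε, z) ⟨hε, hz⟩).trans (le_max_left _ _)
    · simp [image_eq_zero_of_notMem_tsupport hz]
  have hscale {ε : ℝ} (hε : 0 < ε) (w : EuclideanSpace ℝ (Fin 3)) :
      √(ε ^ 2 + ‖ε • w‖ ^ 2) = ε * √(1 + ‖w‖ ^ 2) := by
    rw [norm_smul, Real.norm_of_nonneg hε.le, mul_pow, ← mul_one_add,
      Real.sqrt_mul (by positivity), Real.sqrt_sq hε.le]
  have hchange {ε : ℝ} (hε : 0 < ε) :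
      ∫ z, (ε ^ 2 * greenRadial'' k √(ε ^ 2 + ‖z‖ ^ 2)) * g z
        = ∫ w, (H √(ε ^ 2 + ‖ε • w‖ ^ 2) * g (ε • w)) *
            ((1 / √(1 + ‖w‖ ^ 2) ^ 5 : ℝ) : ℂ) := by
    have h := Measure.integral_comp_smul (volume : Measure (EuclideanSpace ℝ (Fin 3)))
      (fun z => (ε ^ 2 * greenRadial'' k √(ε ^ 2 + ‖z‖ ^ 2)) * g z) ε
    have hε' : (ε : ℂ) ≠ 0 := by exact_mod_cast hε.ne'
    rw [finrank_euclideanSpace, Fintype.card_fin, abs_of_pos (by positivity),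
      Complex.real_smul] at h
    have h' : ∫ z, (ε ^ 2 * greenRadial'' k √(ε ^ 2 + ‖z‖ ^ 2)) * g z = (ε : ℂ) ^ 3 *
        ∫ w, (ε ^ 2 * greenRadial'' k √(ε ^ 2 + ‖ε • w‖ ^ 2)) * g (ε • w) := by
      rw [h]; push_cast; field_simp
    rw [h', ← integral_const_mul]
    refine integral_congr_ae (.of_forall fun w => ?_)
    have hw : 0 < √(1 + ‖w‖ ^ 2) := by positivity
    have hw' : ((√(1 + ‖w‖ ^ 2) : ℝ) : ℂ) ≠ 0 := by exact_mod_cast hw.ne'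
    simp only [hscale hε, hH, greenRadial'']
    push_cast
    field_simp
  have hlim : ∫ w : EuclideanSpace ℝ (Fin 3), (H 0 * g 0) *
      ((1 / √(1 + ‖w‖ ^ 2) ^ 5 : ℝ) : ℂ) = g 0 := by
    rw [integral_const_mul, integral_complex_ofReal, integral_one_div_sqrt_pow_five]
    simp only [hH]
    push_cast
    field_simp
    simp
  rw [← hlim]
  refine Tendsto.congr' (f₁ := fun ε : ℝ => ∫ w, (H √(ε ^ 2 + ‖ε • w‖ ^ 2) * g (ε • w)) *
            ((1 / √(1 + ‖w‖ ^ 2) ^ 5 : ℝ) : ℂ)) ?_ ?_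
  · filter_upwards [self_mem_nhdsWithin] with ε hε
    exact (hchange hε).symm
  refine tendsto_integral_filter_of_dominated_convergence
    (fun w => M * (1 / √(1 + ‖w‖ ^ 2) ^ 5)) ?_ ?_ (integrable_one_div_sqrt_pow_five.const_mul M) ?_
  · filter_upwards with ε
    refine AEStronglyMeasurable.mul (Continuous.aestronglyMeasurable (by fun_prop))
      (Complex.continuous_ofReal.comp_aestronglyMeasurable
        integrable_one_div_sqrt_pow_five.aestronglyMeasurable)
  · filter_upwards [Ioc_mem_nhdsGT one_pos] with ε hε
    refine .of_forall fun w => ?_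
    rw [norm_mul, Complex.norm_real, Real.norm_of_nonneg (by positivity)]
    gcongr
    exact hM ε ⟨hε.1.le, hε.2⟩ _
  · refine .of_forall fun w => Tendsto.mul_const _ ?_
    have : Continuous fun ε : ℝ => H √(ε ^ 2 + ‖ε • w‖ ^ 2) * g (ε • w) := by fun_prop
    exact (this.tendsto' 0 _ (by simp)).mono_left nhdsWithin_le_nhds

/-- `greenRadial k ‖·‖` is a fundamental solution of `-(Δ + k²)`. -/
lemma integral_green_mul_helmholtz (k : ℝ) {g : EuclideanSpace ℝ (Fin 3) → ℂ}
    (hg : ContDiff ℝ 2 g) (hc : HasCompactSupport g) :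
    ∫ z, greenRadial k ‖z‖ * (laplacianC g z + k ^ 2 * g z) = - g 0 := by
  have hkc : Continuous fun z => (k : ℂ) ^ 2 * g z := continuous_const.mul hg.continuous
  have hck : HasCompactSupport fun z => (k : ℂ) ^ 2 * g z := hc.mul_left
  have hF : Continuous fun z => laplacianC g z + (k : ℂ) ^ 2 * g z :=
    (continuous_laplacianC hg).add hkc
  have hFc : HasCompactSupport fun z => laplacianC g z + (k : ℂ) ^ 2 * g z :=
    (hasCompactSupport_laplacianC hc).add hck
  refine tendsto_nhds_unique (tendsto_integral_greenReg_mul k hF hFc)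
    ((tendsto_integral_greenRadial''_mul k hg.continuous hc).neg.congr' ?_)
  filter_upwards [self_mem_nhdsWithin] with ε hε
  have hu := contDiff_greenReg k hε
  have hku : Continuous fun z => (k : ℂ) ^ 2 * greenReg k ε z := continuous_const.mul hu.continuous
  have hi {u v : EuclideanSpace ℝ (Fin 3) → ℂ} (hu : Continuous u) (hv : Continuous v)
      (hvc : HasCompactSupport v) : Integrable (fun z => u z * v z) :=
    (hu.mul hv).integrable_of_hasCompactSupport hvc.mul_left
  have h1 : ∫ z, greenReg k ε z * (laplacianC g z + k ^ 2 * g z)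
      = ∫ z, (laplacianC (greenReg k ε) z + k ^ 2 * greenReg k ε z) * g z := by
    simp only [mul_add, add_mul]
    rw [integral_add (hi hu.continuous (continuous_laplacianC hg) (hasCompactSupport_laplacianC hc))
        (hi hu.continuous hkc hck),
      integral_add (hi (continuous_laplacianC hu) hg.continuous hc)
        (hi hku hg.continuous hc),
      integral_mul_laplacianC hu hg hc]
    congr 2
    ext z
    ring
  rw [h1, ← integral_neg]
  refine integral_congr_ae (.of_forall fun z => ?_)
  simp only [laplacianC_greenReg k hε, neg_mul]

open scoped Convolution

lemma partialC_convolution {G g : EuclideanSpace ℝ (Fin 3) → ℂ} (hG : LocallyIntegrable G)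
    (hg : ContDiff ℝ 1 g) (hc : HasCompactSupport g) (i : Fin 3) :
    partialC i (G ⋆[ContinuousLinearMap.mul ℝ ℂ] g)
      = G ⋆[ContinuousLinearMap.mul ℝ ℂ] partialC i g := by
  ext x
  rw [partialC, (hc.hasFDerivAt_convolution_right _ hG hg x).fderiv,
    convolution_precompR_apply _ hG (hc.fderiv ℝ) (hg.continuous_fderiv one_ne_zero)]
  rfl

lemma laplacianC_convolution {G g : EuclideanSpace ℝ (Fin 3) → ℂ} (hG : LocallyIntegrable G)
    (hg : ContDiff ℝ 2 g) (hc : HasCompactSupport g) (x : EuclideanSpace ℝ (Fin 3)) :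
    laplacianC (G ⋆[ContinuousLinearMap.mul ℝ ℂ] g) x
      = ∫ t, G t * laplacianC g (x - t) := by
  have hg1 i : ContDiff ℝ 1 (partialC i g) :=
    contDiff_partialC (n := 2) (m := 1) hg (by norm_num) i
  have hg2 i : ContDiff ℝ 0 (partialC i (partialC i g)) :=
    contDiff_partialC (n := 1) (m := 0) (hg1 i) (by simp) i
  have hc2 i := hasCompactSupport_partialC (hasCompactSupport_partialC hc i) i
  simp only [laplacianC_eq_sum, Finset.mul_sum]
  have hint i : Integrable fun t => G t * partialC i (partialC i g) (x - t) :=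
    (hc2 i).convolutionExists_right (ContinuousLinearMap.mul ℝ ℂ) hG (hg2 i).continuous x
  rw [integral_finsetSum _ fun i _ => hint i]
  refine Finset.sum_congr rfl fun i _ => ?_
  rw [partialC_convolution hG (hg.of_le (by norm_num)) hc,
    partialC_convolution hG (hg1 i) (hasCompactSupport_partialC hc i)]
  simp [convolution_def]

/-- The Helmholtz volume potential `φ(x) = ∫ (e^{ik|x−y|}/(4π|x−y|)) f(y) dy` of a smooth
compactly supported `f : ℝ³ → ℂ` is twice continuously differentiable and satisfies
`Δφ + k²φ = −f`. -/
theorem stmt_18 (k : ℝ) (hk : 0 < k)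
    (f : EuclideanSpace ℝ (Fin 3) → ℂ)
    (hf : ContDiff ℝ (⊤ : ℕ∞) f) (hsupp : HasCompactSupport f)
    (φ : EuclideanSpace ℝ (Fin 3) → ℂ)
    (hφ : ∀ x, φ x = ∫ y,
      Complex.exp (Complex.I * (k : ℂ) * (‖x - y‖ : ℂ)) / ((4 * Real.pi * ‖x - y‖ : ℝ) : ℂ) * f y) :
    ContDiff ℝ 2 φ ∧ ∀ x, laplacianC φ x + (k : ℂ) ^ 2 * φ x = -f x := by
  set G : EuclideanSpace ℝ (Fin 3) → ℂ := fun z => greenRadial k ‖z‖ with hGdef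
  have hG : LocallyIntegrable G := locallyIntegrable_green k
  have hf2 : ContDiff ℝ 2 f := contDiff_infty.mp hf 2
  have hφG : φ = G ⋆[ContinuousLinearMap.mul ℝ ℂ] f := by
    ext x
    rw [hφ, convolution_def, ← integral_sub_left_eq_self _ volume x]
    simp [hGdef, greenRadial]
  refine ⟨hφG ▸ hsupp.contDiff_convolution_right (n := 2) _ hG hf2, fun x => ?_⟩
  set g : EuclideanSpace ℝ (Fin 3) → ℂ := fun y => f (x - y) with hgdef
  have hg : ContDiff ℝ 2 g := hf2.comp (contDiff_const.sub contDiff_id)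
  have hgc : HasCompactSupport g := hsupp.comp_homeomorph (Homeomorph.subLeft x)
  have hgkc : Continuous fun z => (k : ℂ) ^ 2 * g z := continuous_const.mul hg.continuous
  have hgck : HasCompactSupport fun z => (k : ℂ) ^ 2 * g z := hgc.mul_left
  have hmain := integral_green_mul_helmholtz k hg hgc
  simp only [mul_add] at hmain
  rw [integral_add (integrable_green_mul k (continuous_laplacianC hg)
      (hasCompactSupport_laplacianC hgc))
    (integrable_green_mul k hgkc hgck)] at hmain
  have h0 : g 0 = f x := by simp [hgdef]
  rw [← h0, ← hmain, hφG, laplacianC_convolution hG hf2 hsupp, convolution_def,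
    ← integral_const_mul]
  congr 1
  · refine integral_congr_ae (.of_forall fun t => ?_)
    simp only [hgdef, laplacianC_comp_const_sub, hGdef]
  · refine integral_congr_ae (.of_forall fun t => ?_)
    simp only [hgdef, hGdef, ContinuousLinearMap.mul_apply']
    ring
end
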